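/- Let Σ be a finite alphabet, k ≥ 1, and let @ be a symbol not in Σ. For every tree automaton T over labeled k-trees over Σ there exists a tree automaton T' over binary labeled trees over Σ ∪ {@} such that for every n ≥ 1, |{t ∈ L(T) : |t| = n}| = |{t' ∈ L(T') : |t'| = 2n − 1}|. -/

import Mathlib

/-- A labeled `k`-tree over alphabet `A`: a finite nonempty prefix-closed set of
words over `[k]` (encoded as `List (Fin k)`), each node carrying a label in `A`.
`label w = some a` means `w` is a node labeled `a`; `label w = none` means `w` is not a node. -/
structure LTree (k : ℕ) (A : Type) : Type where
  label : List (Fin k) → Option A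
  root_isSome : (label []).isSome
  finite_nodes : {w : List (Fin k) | (label w).isSome}.Finite
  prefix_closed : ∀ (w : List (Fin k)) (i : Fin k), (label (w ++ [i])).isSome →
      (label w).isSome ∧ ∀ j : Fin k, j ≤ i → (label (w ++ [j])).isSome

namespace LTree

variable {k : ℕ} {A : Type}

def IsNode (t : LTree k A) (w : List (Fin k)) : Prop := (t.label w).isSome

/-- The number of nodes `|t|` of a tree. -/
noncomputable def size (t : LTree k A) : ℕ := {w | t.IsNode w}.ncard

/-- The (ordered) list of directions to the children of a node. -/
def children (t : LTree k A) (w : List (Fin k)) : List (Fin k) :=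
  (List.finRange k).filter (fun i => (t.label (w ++ [i])).isSome)

/-- A `2`-tree is a binary tree if every node has either two children or none. -/
def IsBinary (t : LTree 2 A) : Prop :=
  ∀ w, t.IsNode w → (t.IsNode (w ++ [(0 : Fin 2)]) ↔ t.IsNode (w ++ [(1 : Fin 2)]))

end LTree

/-- A run of the transition relation `Δ` over the tree `t`:
`ρ` assigns states to nodes consistently with `Δ`. -/
def IsRunOn {k : ℕ} {S A : Type} (Δ : Set (S × A × List S))
    (t : LTree k A) (ρ : List (Fin k) → S) : Prop :=
  ∀ w a, t.label w = some a →
    (ρ w, a, (t.children w).map fun i => ρ (w ++ [i])) ∈ Δ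

/-- The tree `t` is accepted starting from state `s`. -/
def AcceptsFrom {k : ℕ} {S A : Type} (Δ : Set (S × A × List S)) (s : S) (t : LTree k A) : Prop :=
  ∃ ρ, IsRunOn Δ t ρ ∧ ρ [] = s

/-- A (top-down) tree automaton over labeled `k`-trees. -/
structure TreeAutomaton (k : ℕ) (S A : Type) where
  delta : Set (S × A × List S)
  arity_le : ∀ tr ∈ delta, (tr.2.2).length ≤ k
  init : S

/-- The language of a tree automaton over `k`-trees. -/
def TreeAutomaton.lang {k : ℕ} {S A : Type} (T : TreeAutomaton k S A) : Set (LTree k A) :=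
  {t | AcceptsFrom T.delta T.init t}

/-- The transition relation of a tree automaton over binary trees:
transitions are of the form `(s, a, λ)` or `(s, a, q·r)`. -/
def IsBinaryDelta {S A : Type} (Δ : Set (S × A × List S)) : Prop :=
  ∀ tr ∈ Δ, tr.2.2 = [] ∨ ∃ q r : S, tr.2.2 = [q, r]

/-- The language, over binary labeled trees, accepted from state `s`. -/
def blangFrom {S A : Type} (Δ : Set (S × A × List S)) (s : S) : Set (LTree 2 A) :=
  {t | t.IsBinary ∧ AcceptsFrom Δ s t}

namespace LTree

variable {k : ℕ} {A S : Type}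

theorem eq_of_label_eq {t u : LTree k A} (h : ∀ w, t.label w = u.label w) : t = u := by
  obtain ⟨f, _, _, _⟩ := t
  obtain ⟨g, _, _, _⟩ := u
  obtain rfl : f = g := funext h
  rfl

theorem isSome_of_isSome_cons (t : LTree k A) (i : Fin k) (w : List (Fin k))
    (h : (t.label (i :: w)).isSome) : (t.label [i]).isSome := by
  induction w using List.reverseRecOn with
  | nil => exact h
  | append_singleton w j ih => exact ih (t.prefix_closed (i :: w) j h).1

/-- The number of children of the root. -/
noncomputable def arity (t : LTree k A) : ℕ :=
  sInf {n | ∀ h : n < k, t.label [⟨n, h⟩] = none}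

theorem arity_mem (t : LTree k A) : ∀ h : t.arity < k, t.label [⟨t.arity, h⟩] = none :=
  Nat.sInf_mem (s := {n | ∀ h : n < k, t.label [⟨n, h⟩] = none})
    ⟨k, fun h => absurd h (lt_irrefl k)⟩

theorem arity_le (t : LTree k A) : t.arity ≤ k :=
  Nat.sInf_le fun h => absurd h (lt_irrefl k)

theorem isSome_singleton_iff (t : LTree k A) (i : Fin k) :
    (t.label [i]).isSome ↔ i.val < t.arity := by
  constructor
  · intro h
    by_contra! hle
    have := (t.prefix_closed [] i h).2 ⟨t.arity, by omega⟩ hle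
    simp [t.arity_mem (by omega)] at this
  · intro h
    have := Nat.notMem_of_lt_sInf h
    simpa [Option.isSome_iff_ne_none] using this

theorem arity_eq {t : LTree k A} {n : ℕ} (hn : n ≤ k)
    (h : ∀ i : Fin k, (t.label [i]).isSome ↔ i.val < n) : t.arity = n := by
  have hk := t.arity_le
  simp only [isSome_singleton_iff] at h
  by_contra hne
  rcases lt_or_gt_of_ne hne with hlt | hlt
  · exact lt_irrefl _ ((h ⟨t.arity, by omega⟩).2 hlt)
  · exact lt_irrefl _ ((h ⟨n, by omega⟩).1 hlt)

theorem lt_arity_of_isSome_cons (t : LTree k A) (i : Fin k) (w : List (Fin k))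
    (h : (t.label (i :: w)).isSome) : i.val < t.arity :=
  (t.isSome_singleton_iff i).1 (t.isSome_of_isSome_cons i w h)

theorem label_cons_eq_none (t : LTree k A) (i : Fin k) (w : List (Fin k))
    (h : t.arity ≤ i.val) : t.label (i :: w) = none := by
  by_contra hne
  have := t.lt_arity_of_isSome_cons i w (Option.isSome_iff_ne_none.2 hne)
  omega

theorem children_nil (t : LTree k A) :
    t.children [] = (List.finRange k).filter (fun i => i.val < t.arity) := by
  unfold children
  congr 1
  funext i
  rw [Bool.eq_iff_iff]
  simpa using t.isSome_singleton_iff i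

theorem filter_finRange_lt_succ {n : ℕ} (h : n < k) :
    (List.finRange k).filter (fun i => i.val < n + 1) =
      (List.finRange k).filter (fun i => i.val < n) ++ [⟨n, h⟩] := by
  have hp : ∀ m : ℕ, ((List.finRange k).filter (fun i => i.val < m)).Pairwise (· < ·) :=
    fun m => (List.pairwise_lt_finRange k).filter _
  refine List.Pairwise.eq_of_mem_iff (hp _) ?_ ?_
  · rw [List.pairwise_append]
    refine ⟨hp _, List.pairwise_singleton _ _, ?_⟩
    intro a ha b hb
    simp only [List.mem_filter, List.mem_finRange, true_and, decide_eq_true_eq,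
      List.mem_singleton] at ha hb
    subst hb
    exact ha
  · intro a
    simp only [List.mem_filter, List.mem_finRange, true_and, decide_eq_true_eq,
      List.mem_append, List.mem_singleton, Fin.ext_iff]
    omega

/-- The tree with a single node. -/
def single (k : ℕ) (a : A) : LTree k A where
  label
    | [] => some a
    | _ :: _ => none
  root_isSome := rfl
  finite_nodes := (Set.finite_singleton []).subset fun w hw => by
    cases w with
    | nil => rfl
    | cons => simp at hw
  prefix_closed w i h := by cases w <;> simp at h

@[simp] theorem single_label_nil (a : A) : (single k a).label [] = some a := rfl

@[simp] theorem single_label_cons (a : A) (i : Fin k) (w : List (Fin k)) :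
    (single k a).label (i :: w) = none := rfl

@[simp] theorem arity_single (a : A) : (single k a).arity = 0 :=
  arity_eq (Nat.zero_le k) (by simp)

theorem size_single (a : A) : (single k a).size = 1 := by
  have : {w | (single k a).IsNode w} = {[]} := by
    ext w
    cases w <;> simp [IsNode]
  rw [size, this, Set.ncard_singleton]

theorem eq_single {t : LTree k A} (h : t.arity = 0) : ∃ a, t = single k a := by
  obtain ⟨a, ha⟩ := Option.isSome_iff_exists.1 t.root_isSome
  refine ⟨a, eq_of_label_eq fun w => ?_⟩
  cases w with
  | nil => exact ha
  | cons i w => exact t.label_cons_eq_none i w (by omega)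

/-- The label function of `snoc`. -/
noncomputable def snocLabel (t u : LTree k A) : List (Fin k) → Option A
  | [] => t.label []
  | i :: w => if i.val = t.arity then u.label w else t.label (i :: w)

/-- `t.snoc u` attaches `u` as a new last child of the root of `t`
(and is `t` itself if the root of `t` already has `k` children). -/
noncomputable def snoc (t u : LTree k A) : LTree k A where
  label := snocLabel t u
  root_isSome := t.root_isSome
  finite_nodes := by
    have hfin : (⋃ i : Fin k, (List.cons i) '' {w | (u.label w).isSome}).Finite :=
      Set.finite_iUnion fun i => u.finite_nodes.image _
    refine (t.finite_nodes.union hfin).subset fun w hw => ?_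
    cases w with
    | nil => exact Or.inl hw
    | cons i w =>
      by_cases hi : i.val = t.arity
      · exact Or.inr (Set.mem_iUnion.2 ⟨i, w, by simpa [snocLabel, hi] using hw, rfl⟩)
      · exact Or.inl (by simpa [snocLabel, hi] using hw)
  prefix_closed w i h := by
    cases w with
    | nil =>
      refine ⟨t.root_isSome, fun j hj => ?_⟩
      have hj' : j.val ≤ i.val := hj
      have hi : i.val ≤ t.arity := by
        by_contra! hlt
        have hne : i.val ≠ t.arity := by omega
        have := t.lt_arity_of_isSome_cons i [] (by simpa [snocLabel, hne] using h)
        omega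
      by_cases hja : j.val = t.arity
      · simpa [snocLabel, hja] using u.root_isSome
      · simpa [snocLabel, hja] using (t.isSome_singleton_iff j).2 (by omega)
    | cons j w =>
      by_cases hj : j.val = t.arity
      · simpa [snocLabel, hj] using u.prefix_closed w i (by simpa [snocLabel, hj] using h)
      · simpa [snocLabel, hj] using
          t.prefix_closed (j :: w) i (by simpa [snocLabel, hj] using h)

@[simp] theorem snoc_label_nil (t u : LTree k A) : (t.snoc u).label [] = t.label [] := rfl

theorem snoc_label_cons (t u : LTree k A) (i : Fin k) (w : List (Fin k)) :
    (t.snoc u).label (i :: w) =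
      if i.val = t.arity then u.label w else t.label (i :: w) := rfl

theorem snoc_label_last {t : LTree k A} (h : t.arity < k) (u : LTree k A) (w : List (Fin k)) :
    (t.snoc u).label (⟨t.arity, h⟩ :: w) = u.label w := by
  simp [snoc_label_cons]

theorem arity_snoc {t : LTree k A} (h : t.arity < k) (u : LTree k A) :
    (t.snoc u).arity = t.arity + 1 := by
  refine arity_eq h fun i => ?_
  by_cases hi : i.val = t.arity
  · simp [snoc_label_cons, hi, u.root_isSome]
  · simp only [snoc_label_cons, hi, if_false, isSome_singleton_iff]
    omega

theorem size_snoc {t : LTree k A} (h : t.arity < k) (u : LTree k A) :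
    (t.snoc u).size = t.size + u.size := by
  have hset : {w | (t.snoc u).IsNode w} =
      {w | t.IsNode w} ∪ (List.cons ⟨t.arity, h⟩) '' {w | u.IsNode w} := by
    ext w
    cases w with
    | nil => simp [IsNode]
    | cons i w =>
      by_cases hi : i.val = t.arity
      · obtain rfl : i = ⟨t.arity, h⟩ := Fin.ext hi
        simp [IsNode, snoc_label_last, t.label_cons_eq_none]
      · have : (⟨t.arity, h⟩ : Fin k) ≠ i := fun e => hi (by rw [← e])
        simp [IsNode, snoc_label_cons, hi, this]
  have hdisj : Disjoint {w | t.IsNode w} ((List.cons ⟨t.arity, h⟩) '' {w | u.IsNode w}) := by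
    rw [Set.disjoint_right]
    rintro _ ⟨w, _, rfl⟩
    simp [IsNode, t.label_cons_eq_none]
  rw [size, hset, Set.ncard_union_eq hdisj t.finite_nodes (u.finite_nodes.image _),
    Set.ncard_image_of_injective _ List.cons_injective]
  rfl

theorem size_pos (t : LTree k A) : 0 < t.size :=
  (Set.ncard_pos t.finite_nodes).2 ⟨[], t.root_isSome⟩

theorem snoc_inj {t u t' u' : LTree k A} (h : t.arity < k) (h' : t'.arity < k)
    (heq : t.snoc u = t'.snoc u') : t = t' ∧ u = u' := by
  have ha : t.arity = t'.arity := by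
    have := congrArg arity heq
    rw [arity_snoc h, arity_snoc h'] at this
    omega
  have hl : ∀ w, (t.snoc u).label w = (t'.snoc u').label w := fun w => by rw [heq]
  refine ⟨eq_of_label_eq fun w => ?_, eq_of_label_eq fun w => ?_⟩
  · cases w with
    | nil => exact hl []
    | cons i w =>
      by_cases hi : i.val = t.arity
      · rw [t.label_cons_eq_none i w hi.ge, t'.label_cons_eq_none i w (by omega)]
      · simpa [snoc_label_cons, hi, ha ▸ hi] using hl (i :: w)
  · have := hl (⟨t.arity, h⟩ :: w)
    simpa [snoc_label_cons, ha] using this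

/-- Every tree with a non-leaf root arises by attaching a last child. -/
theorem exists_eq_snoc {t : LTree k A} (h : t.arity ≠ 0) :
    ∃ x y : LTree k A, x.arity < k ∧ t = x.snoc y := by
  have hk := t.arity_le
  obtain ⟨n, hn⟩ := Nat.exists_eq_succ_of_ne_zero h
  have hnk : n < k := by omega
  let i : Fin k := ⟨n, hnk⟩
  let x : LTree k A :=
    { label := fun w => if w.head? = some i then none else t.label w
      root_isSome := by simpa using t.root_isSome
      finite_nodes := t.finite_nodes.subset fun w hw => by
        by_cases hi : w.head? = some i
        · simp [hi] at hw
        · simpa [hi] using hw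
      prefix_closed := fun w j hj => by
        cases w with
        | nil =>
          by_cases hji : j = i
          · simp [hji] at hj
          · simp only [List.nil_append, List.head?_cons, Option.some.injEq, hji, if_false] at hj
            have hjn := t.lt_arity_of_isSome_cons j [] hj
            have hjn' : j.val ≠ n := fun e => hji (Fin.ext e)
            refine ⟨by simpa using t.root_isSome, fun l hl => ?_⟩
            have hl' : l.val ≤ j.val := hl
            have hli : l ≠ i := fun e => by
              have : l.val = n := by rw [e]
              omega
            simpa [hli] using (t.prefix_closed [] j hj).2 l hl
        | cons l w =>
          by_cases hli : l = i
          · simp [hli] at hj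
          · simpa [hli] using t.prefix_closed (l :: w) j (by simpa [hli] using hj) }
  let y : LTree k A :=
    { label := fun w => t.label (i :: w)
      root_isSome := (t.isSome_singleton_iff i).2 (by simp only [i]; omega)
      finite_nodes := t.finite_nodes.preimage (f := List.cons i) List.cons_injective.injOn
      prefix_closed := fun w j hj => t.prefix_closed (i :: w) j hj }
  have hx : x.arity = n := by
    refine arity_eq hnk.le fun j => ?_
    by_cases hji : j = i
    · simp [x, hji, i]
    · have hjn : j.val ≠ n := fun e => hji (Fin.ext e)
      simp only [x, List.head?_cons, Option.some.injEq, hji, if_false, isSome_singleton_iff]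
      omega
  refine ⟨x, y, by omega, eq_of_label_eq fun w => ?_⟩
  cases w with
  | nil => simp [x]
  | cons j w =>
    by_cases hjn : j.val = n
    · obtain rfl : j = i := Fin.ext hjn
      simp [snoc_label_cons, hx, hjn, y]
    · have hji : j ≠ i := fun e => hjn (by rw [e])
      simp [snoc_label_cons, hx, hjn, x, hji]

theorem children_nil_single (a : A) : (single k a).children [] = [] := by
  simp [children_nil]

theorem children_nil_snoc {t : LTree k A} (h : t.arity < k) (u : LTree k A) :
    (t.snoc u).children [] = t.children [] ++ [⟨t.arity, h⟩] := by
  rw [children_nil, children_nil, arity_snoc h, filter_finRange_lt_succ h]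

theorem children_cons_snoc (t u : LTree k A) (i : Fin k) (w : List (Fin k)) :
    (t.snoc u).children (i :: w) =
      if i.val = t.arity then u.children w else t.children (i :: w) := by
  by_cases hi : i.val = t.arity <;> simp [children, snoc_label_cons, hi]

/-- `t` has a run from `s` whose root transition has the states `l` appended to those of the
children of the root. -/
def AcceptsWith (Δ : Set (S × A × List S)) (s : S) (l : List S) (t : LTree k A) : Prop :=
  ∃ ρ : List (Fin k) → S, ρ [] = s ∧
    (∀ a, t.label [] = some a → (s, a, (t.children []).map (fun i => ρ [i]) ++ l) ∈ Δ) ∧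
    ∀ i w a, t.label (i :: w) = some a →
      (ρ (i :: w), a, (t.children (i :: w)).map fun j => ρ (i :: w ++ [j])) ∈ Δ

theorem acceptsWith_nil_iff {Δ : Set (S × A × List S)} {s : S} {t : LTree k A} :
    AcceptsWith Δ s [] t ↔ AcceptsFrom Δ s t := by
  constructor
  · rintro ⟨ρ, rfl, h₀, h⟩
    refine ⟨ρ, fun w a hw => ?_, rfl⟩
    cases w with
    | nil => simpa using h₀ a hw
    | cons i w => exact h i w a hw
  · rintro ⟨ρ, h, rfl⟩
    exact ⟨ρ, rfl, fun a ha => by simpa using h [] a ha, fun i w a hw => h (i :: w) a hw⟩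

theorem acceptsWith_single {Δ : Set (S × A × List S)} {s : S} {l : List S} {a : A} :
    AcceptsWith Δ s l (single k a) ↔ (s, a, l) ∈ Δ := by
  constructor
  · rintro ⟨ρ, -, h₀, -⟩
    simpa [children_nil_single] using h₀ a rfl
  · intro h
    refine ⟨fun _ => s, rfl, fun b hb => ?_, fun i w b hb => by simp at hb⟩
    obtain rfl : a = b := by simpa using hb
    simpa [children_nil_single] using h

theorem acceptsWith_snoc {Δ : Set (S × A × List S)} {s : S} {l : List S} {t u : LTree k A}
    (h : t.arity < k) :
    AcceptsWith Δ s l (t.snoc u) ↔ ∃ q, AcceptsWith Δ s (q :: l) t ∧ AcceptsFrom Δ q u := by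
  constructor
  · rintro ⟨ρ, hs, h₀, hρ⟩
    refine ⟨ρ [⟨t.arity, h⟩], ⟨ρ, hs, fun a ha => ?_, fun i w a ha => ?_⟩,
      ⟨fun w => ρ (⟨t.arity, h⟩ :: w), fun w a ha => ?_, rfl⟩⟩
    · simpa [children_nil_snoc h] using h₀ a ha
    · have hi := (t.lt_arity_of_isSome_cons i w (by simp [ha])).ne
      simpa [children_cons_snoc, hi] using hρ i w a (by simp [snoc_label_cons, hi, ha])
    · simpa [children_cons_snoc] using hρ _ w a ((snoc_label_last h u w).trans ha)
  · rintro ⟨q, ⟨ρ, hs, h₀, hρ⟩, ⟨σ, hσ, rfl⟩⟩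
    let τ : List (Fin k) → S
      | [] => s
      | i :: w => if i.val = t.arity then σ w else ρ (i :: w)
    refine ⟨τ, rfl, fun a ha => ?_, fun i w a ha => ?_⟩
    · have hmap : (t.children []).map (fun i => τ [i]) = (t.children []).map fun i => ρ [i] := by
        refine List.map_congr_left fun i hi => ?_
        have : i.val < t.arity := by simpa [children_nil] using hi
        simp [τ, this.ne]
      simpa [children_nil_snoc h, hmap, τ] using h₀ a ha
    · by_cases hi : i.val = t.arity
      · simpa [children_cons_snoc, hi, τ] using hσ w a (by simpa [snoc_label_cons, hi] using ha)
      · simpa [children_cons_snoc, hi, τ] using hρ i w a (by simpa [snoc_label_cons, hi] using ha)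

theorem isBinary_of_acceptsFrom {Δ : Set (S × A × List S)} (hΔ : IsBinaryDelta Δ) {s : S}
    {t : LTree 2 A} (h : AcceptsFrom Δ s t) : t.IsBinary := by
  obtain ⟨ρ, hρ, -⟩ := h
  intro w hw
  obtain ⟨a, ha⟩ := Option.isSome_iff_exists.1 hw
  have hlen : (t.children w).length = 0 ∨ (t.children w).length = 2 := by
    rcases hΔ _ (hρ w a ha) with h0 | ⟨q, r, h2⟩
    · exact Or.inl (by simpa using congrArg List.length h0)
    · exact Or.inr (by simpa using congrArg List.length h2)
  have hfin : List.finRange 2 = [0, 1] := rfl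
  unfold IsNode
  by_cases h₀ : (t.label (w ++ [0])).isSome <;> by_cases h₁ : (t.label (w ++ [1])).isSome <;>
    simp_all [children]

end LTree

namespace FreeMagma

open LTree

variable {k : ℕ} {A S : Type}

/-- Uncurrying: `x * y` attaches the tree of `y` as the last child of the root of the
tree of `x`. -/
noncomputable def toTree (k : ℕ) : FreeMagma A → LTree k A
  | .of a => single k a
  | x * y => (toTree k x).snoc (toTree k y)

theorem toTree_of (a : A) : toTree k (.of a) = single k a := rfl

theorem toTree_mul (x y : FreeMagma A) :
    toTree k (x * y) = (toTree k x).snoc (toTree k y) := rfl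

/-- The binary tree with leaves labeled by `A` and inner nodes labeled by the fresh symbol. -/
noncomputable def toBinaryTree : FreeMagma A → LTree 2 (Option A)
  | .of a => single 2 (some a)
  | x * y => ((single 2 none).snoc (toBinaryTree x)).snoc (toBinaryTree y)

theorem toBinaryTree_of (a : A) : toBinaryTree (.of a) = single 2 (some a) := rfl

theorem toBinaryTree_mul (x y : FreeMagma A) :
    (x * y).toBinaryTree =
      ((single 2 none).snoc x.toBinaryTree).snoc y.toBinaryTree := rfl

/-- `m.Accepts Δ s l` holds if the tree encoded by `m` has a run of `Δ` from `s` in which the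
states `l` are appended to those of the children of the root. -/
def Accepts (Δ : Set (S × A × List S)) : FreeMagma A → S → List S → Prop
  | .of a, s, l => (s, a, l) ∈ Δ
  | x * y, s, l => ∃ q, Accepts Δ x s (q :: l) ∧ Accepts Δ y q []

theorem Accepts.arity_add_length_le {Δ : Set (S × A × List S)}
    (hΔ : ∀ tr ∈ Δ, tr.2.2.length ≤ k) {m : FreeMagma A} {s : S} {l : List S}
    (h : m.Accepts Δ s l) : (toTree k m).arity + l.length ≤ k := by
  induction m generalizing s l with
  | ih1 a => simpa [toTree_of] using hΔ _ h
  | ih2 x y ihx ihy =>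
    obtain ⟨q, hx, -⟩ := h
    have := ihx hx
    rw [List.length_cons] at this
    rw [toTree_mul, arity_snoc (by omega)]
    omega

theorem Accepts.arity_lt {Δ : Set (S × A × List S)}
    (hΔ : ∀ tr ∈ Δ, tr.2.2.length ≤ k) {m : FreeMagma A} {s q : S} {l : List S}
    (h : m.Accepts Δ s (q :: l)) : (toTree k m).arity < k := by
  have := h.arity_add_length_le hΔ
  rw [List.length_cons] at this
  omega

theorem Accepts.acceptsWith {Δ : Set (S × A × List S)}
    (hΔ : ∀ tr ∈ Δ, tr.2.2.length ≤ k) {m : FreeMagma A} {s : S} {l : List S}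
    (h : m.Accepts Δ s l) : AcceptsWith Δ s l (toTree k m) := by
  induction m generalizing s l with
  | ih1 a => exact acceptsWith_single.2 h
  | ih2 x y ihx ihy =>
    obtain ⟨q, hx, hy⟩ := h
    exact (acceptsWith_snoc (hx.arity_lt hΔ)).2 ⟨q, ihx hx, acceptsWith_nil_iff.1 (ihy hy)⟩

theorem Accepts.size_toTree {Δ : Set (S × A × List S)}
    (hΔ : ∀ tr ∈ Δ, tr.2.2.length ≤ k) {m : FreeMagma A} {s : S} {l : List S}
    (h : m.Accepts Δ s l) : (toTree k m).size = m.length := by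
  induction m generalizing s l with
  | ih1 a => exact size_single a
  | ih2 x y ihx ihy =>
    obtain ⟨q, hx, hy⟩ := h
    rw [toTree_mul, size_snoc (hx.arity_lt hΔ), ihx hx, ihy hy]
    rfl

theorem Accepts.eq_of_toTree_eq {Δ : Set (S × A × List S)}
    (hΔ : ∀ tr ∈ Δ, tr.2.2.length ≤ k) {m m' : FreeMagma A} {s s' : S} {l l' : List S}
    (h : m.Accepts Δ s l) (h' : m'.Accepts Δ s' l') (heq : toTree k m = toTree k m') :
    m = m' := by
  induction m generalizing s l m' s' l' with
  | ih1 a =>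
    cases m' using recOnMul with
    | ih1 b =>
      have := congrArg (fun t => t.label []) heq
      exact congrArg of (by simpa [toTree_of] using this)
    | ih2 x y =>
      obtain ⟨q, hx, -⟩ := h'
      have := congrArg arity heq
      simp [toTree_of, toTree_mul, arity_snoc (hx.arity_lt hΔ)] at this
  | ih2 x y ihx ihy =>
    obtain ⟨q, hx, hy⟩ := h
    cases m' using recOnMul with
    | ih1 b =>
      have := congrArg arity heq
      simp [toTree_of, toTree_mul, arity_snoc (hx.arity_lt hΔ)] at this
    | ih2 x' y' =>
      obtain ⟨q', hx', hy'⟩ := h'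
      obtain ⟨ex, ey⟩ := snoc_inj (hx.arity_lt hΔ) (hx'.arity_lt hΔ) heq
      rw [ihx hx hx' ex, ihy hy hy' ey]

theorem exists_toTree_eq {Δ : Set (S × A × List S)} {t : LTree k A} {s : S} {l : List S}
    (h : AcceptsWith Δ s l t) : ∃ m, m.Accepts Δ s l ∧ toTree k m = t := by
  induction hn : t.size using Nat.strong_induction_on generalizing t s l with
  | _ n ih =>
    by_cases h0 : t.arity = 0
    · obtain ⟨a, rfl⟩ := eq_single h0
      exact ⟨.of a, acceptsWith_single.1 h, rfl⟩
    · obtain ⟨x, y, hlt, rfl⟩ := exists_eq_snoc h0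
      obtain ⟨q, hx, hy⟩ := (acceptsWith_snoc hlt).1 h
      have hsize := size_snoc hlt y
      have hx0 := x.size_pos
      have hy0 := y.size_pos
      obtain ⟨m, hm, rfl⟩ := ih _ (by omega) hx rfl
      obtain ⟨mr, hmr, rfl⟩ := ih _ (by omega) (acceptsWith_nil_iff.2 hy) rfl
      exact ⟨m * mr, ⟨q, hm, hmr⟩, rfl⟩

theorem arity_single_none_snoc (t : LTree 2 (Option A)) :
    ((single 2 none).snoc t).arity = 1 := by
  rw [arity_snoc (by simp), arity_single]

theorem size_toBinaryTree (m : FreeMagma A) :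
    m.toBinaryTree.size = 2 * m.length - 1 := by
  induction m with
  | ih1 a => exact size_single _
  | ih2 x y ihx ihy =>
    have hx := x.length_pos
    have hy := y.length_pos
    rw [toBinaryTree_mul, size_snoc (by simp [arity_single_none_snoc]), size_snoc (by simp),
      size_single, ihx, ihy]
    change _ = 2 * (x.length + y.length) - 1
    omega

theorem toBinaryTree_injective :
    Function.Injective (toBinaryTree : FreeMagma A → LTree 2 (Option A)) := by
  have harity (x y : FreeMagma A) : (x * y).toBinaryTree.arity = 2 := by
    rw [toBinaryTree_mul, arity_snoc (by simp [arity_single_none_snoc]), arity_single_none_snoc]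
  intro m m' heq
  induction m generalizing m' with
  | ih1 a =>
    cases m' using recOnMul with
    | ih1 b =>
      have := congrArg (fun t => t.label []) heq
      exact congrArg of (by simpa [toBinaryTree_of] using this)
    | ih2 x y =>
      have := congrArg arity heq
      rw [harity] at this
      simp [toBinaryTree_of] at this
  | ih2 x y ihx ihy =>
    cases m' using recOnMul with
    | ih1 b =>
      have := congrArg arity heq
      rw [harity] at this
      simp [toBinaryTree_of] at this
    | ih2 x' y' =>
      obtain ⟨e, ey⟩ := snoc_inj (by simp [arity_single_none_snoc])
        (by simp [arity_single_none_snoc]) heq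
      obtain ⟨-, ex⟩ := snoc_inj (by simp) (by simp) e
      rw [ihx ex, ihy ey]

end FreeMagma

namespace TreeAutomaton

open LTree

variable {k : ℕ} {A S : Type}

/-- States of the binary automaton: a state of the original automaton together with the states
of the rightmost children of the current node, which have already been split off. -/
abbrev BinaryState (k : ℕ) (S : Type) : Type := S × {l : List S // l.length ≤ k}

/-- The state in which no child has been split off yet. -/
def BinaryState.start (k : ℕ) (s : S) : BinaryState k S := (s, ⟨[], Nat.zero_le k⟩)

/-- The transitions of the binary automaton: a leaf checks a transition of the original
automaton, and an inner node splits off the last remaining child. -/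
def binaryDelta (k : ℕ) (Δ : Set (S × A × List S)) :
    Set (BinaryState k S × Option A × List (BinaryState k S)) :=
  {tr | (∃ p : BinaryState k S, ∃ a, (p.1, a, p.2.1) ∈ Δ ∧ tr = (p, some a, [])) ∨
    ∃ s q l, ∃ h : (q :: l).length ≤ k,
      tr = ((s, ⟨l, (Nat.le_succ _).trans h⟩), none,
        [(s, ⟨q :: l, h⟩), BinaryState.start k q])}

theorem isBinaryDelta_binaryDelta (Δ : Set (S × A × List S)) :
    IsBinaryDelta (binaryDelta k Δ) := by
  rintro _ (⟨p, a, -, rfl⟩ | ⟨s, q, l, h, rfl⟩)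
  · exact Or.inl rfl
  · exact Or.inr ⟨_, _, rfl⟩

theorem mem_binaryDelta_nil {Δ : Set (S × A × List S)} {p : BinaryState k S} {o : Option A} :
    (p, o, []) ∈ binaryDelta k Δ ↔ ∃ a, o = some a ∧ (p.1, a, p.2.1) ∈ Δ := by
  constructor
  · rintro (⟨p, a, ha, h⟩ | ⟨s, q, l, hl, h⟩)
    · simp only [Prod.mk.injEq] at h
      obtain ⟨rfl, rfl, -⟩ := h
      exact ⟨a, rfl, ha⟩
    · simp at h
  · rintro ⟨a, rfl, h⟩
    exact Or.inl ⟨p, a, h, rfl⟩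

theorem mem_binaryDelta_pair {Δ : Set (S × A × List S)} {p p₁ p₂ : BinaryState k S}
    {o : Option A} :
    (p, o, [p₁, p₂]) ∈ binaryDelta k Δ ↔ o = none ∧ ∃ q, ∃ h : (q :: p.2.1).length ≤ k,
      p₁ = (p.1, ⟨q :: p.2.1, h⟩) ∧ p₂ = BinaryState.start k q := by
  constructor
  · rintro (⟨p, a, ha, h⟩ | ⟨s, q, l, hl, h⟩)
    · simp at h
    · simp only [Prod.mk.injEq, List.cons.injEq, and_true] at h
      obtain ⟨rfl, rfl, rfl, rfl⟩ := h
      exact ⟨rfl, q, hl, rfl, rfl⟩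
  · rintro ⟨rfl, q, h, rfl, rfl⟩
    exact Or.inr ⟨p.1, q, p.2.1, h, rfl⟩

theorem acceptsFrom_single {Δ : Set (S × A × List S)} {s : S} {a : A} :
    AcceptsFrom Δ s (single k a) ↔ (s, a, []) ∈ Δ := by
  rw [← acceptsWith_nil_iff, acceptsWith_single]

theorem acceptsFrom_single_snoc_snoc {Δ : Set (S × A × List S)} {s : S} {a : A}
    {x y : LTree 2 A} :
    AcceptsFrom Δ s (((single 2 a).snoc x).snoc y) ↔
      ∃ p q, (s, a, [p, q]) ∈ Δ ∧ AcceptsFrom Δ p x ∧ AcceptsFrom Δ q y := by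
  have h0 : (single 2 a).arity < 2 := by simp
  have h1 : ((single 2 a).snoc x).arity < 2 := by simp [arity_snoc h0]
  simp only [← acceptsWith_nil_iff (t := ((single 2 a).snoc x).snoc y), acceptsWith_snoc h1,
    acceptsWith_snoc h0, acceptsWith_single]
  constructor
  · rintro ⟨q, ⟨p, hp, hx⟩, hy⟩
    exact ⟨p, q, hp, hx, hy⟩
  · rintro ⟨p, q, hp, hx, hy⟩
    exact ⟨q, ⟨p, hp, hx⟩, hy⟩

theorem acceptsFrom_toBinaryTree {Δ : Set (S × A × List S)}
    (hΔ : ∀ tr ∈ Δ, tr.2.2.length ≤ k) {m : FreeMagma A} {p : BinaryState k S}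
    (h : m.Accepts Δ p.1 p.2.1) : AcceptsFrom (binaryDelta k Δ) p m.toBinaryTree := by
  induction m generalizing p with
  | ih1 a => exact acceptsFrom_single.2 (mem_binaryDelta_nil.2 ⟨a, rfl, h⟩)
  | ih2 x y ihx ihy =>
    obtain ⟨q, hx, hy⟩ := h
    have hlen : (q :: p.2.1).length ≤ k :=
      (Nat.le_add_left _ _).trans (hx.arity_add_length_le hΔ)
    exact acceptsFrom_single_snoc_snoc.2 ⟨_, _,
      mem_binaryDelta_pair.2 ⟨rfl, q, hlen, rfl, rfl⟩, ihx hx, ihy hy⟩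

/-- A tree accepted by a binary transition relation is a leaf or has exactly two subtrees. -/
theorem eq_single_or_eq_snoc_snoc {Δ : Set (S × A × List S)} (hΔ : IsBinaryDelta Δ) {s : S}
    {t : LTree 2 A} (h : AcceptsFrom Δ s t) :
    (∃ a, t = single 2 a) ∨ ∃ a x y, t = ((single 2 a).snoc x).snoc y := by
  by_cases h0 : t.arity = 0
  · exact Or.inl (eq_single h0)
  · obtain ⟨x, y, hx, rfl⟩ := exists_eq_snoc h0
    obtain ⟨q, hq, -⟩ := (acceptsWith_snoc hx).1 (acceptsWith_nil_iff.2 h)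
    by_cases hx0 : x.arity = 0
    · obtain ⟨a, rfl⟩ := eq_single hx0
      rcases hΔ _ (acceptsWith_single.1 hq) with h' | ⟨_, _, h'⟩ <;> simp at h'
    · obtain ⟨x', y', hx', rfl⟩ := exists_eq_snoc hx0
      rw [arity_snoc hx'] at hx
      obtain ⟨a, rfl⟩ := eq_single (t := x') (by omega)
      exact Or.inr ⟨a, y', y, rfl⟩

theorem exists_toBinaryTree_eq {Δ : Set (S × A × List S)} {t : LTree 2 (Option A)}
    {p : BinaryState k S} (h : AcceptsFrom (binaryDelta k Δ) p t) :
    ∃ m : FreeMagma A, m.Accepts Δ p.1 p.2.1 ∧ m.toBinaryTree = t := by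
  induction hn : t.size using Nat.strong_induction_on generalizing t p with
  | _ n ih =>
    rcases eq_single_or_eq_snoc_snoc (isBinaryDelta_binaryDelta Δ) h with
      ⟨o, rfl⟩ | ⟨o, x, y, rfl⟩
    · obtain ⟨a, rfl, ha⟩ := mem_binaryDelta_nil.1 (acceptsFrom_single.1 h)
      exact ⟨.of a, ha, rfl⟩
    · obtain ⟨p₁, p₂, hp, hx, hy⟩ := acceptsFrom_single_snoc_snoc.1 h
      obtain ⟨rfl, q, hq, rfl, rfl⟩ := mem_binaryDelta_pair.1 hp
      have hsize : (((single 2 none).snoc x).snoc y).size = 1 + x.size + y.size := by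
        rw [size_snoc (by simp [FreeMagma.arity_single_none_snoc]), size_snoc (by simp),
          size_single]
      obtain ⟨m, hm, rfl⟩ := ih _ (by omega) hx rfl
      obtain ⟨mr, hmr, rfl⟩ := ih _ (by omega) hy rfl
      exact ⟨m * mr, ⟨q, hm, hmr⟩, rfl⟩

/-- The binary automaton accepting the curried encodings of the trees accepted by `T`. -/
def binary (T : TreeAutomaton k S A) : TreeAutomaton 2 (BinaryState k S) (Option A) where
  delta := binaryDelta k T.delta
  arity_le tr htr := by
    rcases isBinaryDelta_binaryDelta T.delta tr htr with h | ⟨q, r, h⟩ <;> simp [h]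
  init := BinaryState.start k T.init

theorem ncard_lang_size_eq (T : TreeAutomaton k S A) (n : ℕ) :
    {t | t ∈ T.lang ∧ t.size = n}.ncard =
      {m : FreeMagma A | m.Accepts T.delta T.init [] ∧ m.length = n}.ncard := by
  have himage : {t | t ∈ T.lang ∧ t.size = n} =
      FreeMagma.toTree k '' {m | m.Accepts T.delta T.init [] ∧ m.length = n} := by
    ext t
    constructor
    · rintro ⟨ht, rfl⟩
      obtain ⟨m, hm, rfl⟩ := FreeMagma.exists_toTree_eq (acceptsWith_nil_iff.2 ht)
      exact ⟨m, ⟨hm, (hm.size_toTree T.arity_le).symm⟩, rfl⟩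
    · rintro ⟨m, ⟨hm, rfl⟩, rfl⟩
      exact ⟨acceptsWith_nil_iff.1 (hm.acceptsWith T.arity_le), hm.size_toTree T.arity_le⟩
  rw [himage, Set.InjOn.ncard_image]
  exact fun m hm m' hm' heq => hm.1.eq_of_toTree_eq T.arity_le hm'.1 heq

theorem ncard_blangFrom_binary_size_eq (T : TreeAutomaton k S A) {n : ℕ} (hn : 1 ≤ n) :
    {t | t ∈ blangFrom T.binary.delta T.binary.init ∧ t.size = 2 * n - 1}.ncard =
      {m : FreeMagma A | m.Accepts T.delta T.init [] ∧ m.length = n}.ncard := by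
  have himage : {t | t ∈ blangFrom T.binary.delta T.binary.init ∧ t.size = 2 * n - 1} =
      FreeMagma.toBinaryTree '' {m | m.Accepts T.delta T.init [] ∧ m.length = n} := by
    ext t
    constructor
    · rintro ⟨⟨-, ht⟩, hsize⟩
      obtain ⟨m, hm, rfl⟩ := exists_toBinaryTree_eq ht
      rw [FreeMagma.size_toBinaryTree] at hsize
      have := m.length_pos
      exact ⟨m, ⟨hm, by omega⟩, rfl⟩
    · rintro ⟨m, ⟨hm, rfl⟩, rfl⟩
      have h : AcceptsFrom T.binary.delta T.binary.init m.toBinaryTree :=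
        acceptsFrom_toBinaryTree T.arity_le hm
      exact ⟨⟨isBinary_of_acceptsFrom (isBinaryDelta_binaryDelta T.delta) h, h⟩,
        m.size_toBinaryTree⟩
  rw [himage, Set.ncard_image_of_injective _ FreeMagma.toBinaryTree_injective]

end TreeAutomaton

/-- For every tree automaton `T` over labeled `k`-trees over a finite
alphabet `Σ` (here the type `A`), there is a tree automaton `T'` over binary labeled
trees over `Σ ∪ {@}` (here `Option A`, with `none` playing the role of the fresh
symbol `@ ∉ Σ`) such that for every `n ≥ 1`,
`|{t ∈ L(T) : |t| = n}| = |{t' ∈ L(T') : |t'| = 2n − 1}|`. -/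
theorem stmt0 {k : ℕ} (hk : 1 ≤ k) {S A : Type} [Fintype S] [Fintype A]
    (T : TreeAutomaton k S A) :
    ∃ (S' : Type) (_ : Fintype S') (T' : TreeAutomaton 2 S' (Option A)),
      IsBinaryDelta T'.delta ∧
      ∀ n : ℕ, 1 ≤ n →
        {t | t ∈ T.lang ∧ t.size = n}.ncard =
          {t' | t' ∈ blangFrom T'.delta T'.init ∧ t'.size = 2 * n - 1}.ncard := by
  have : Finite {l : List S // l.length ≤ k} := (List.finite_length_le S k).to_subtype
  refine ⟨TreeAutomaton.BinaryState k S, Fintype.ofFinite _, T.binary,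
    TreeAutomaton.isBinaryDelta_binaryDelta T.delta, fun n hn => ?_⟩
  rw [T.ncard_lang_size_eq, T.ncard_blangFrom_binary_size_eq hn]
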